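/- Let R = ℂ[x_{ijk} : i ∈ {1,2}, j ∈ {1,2,3}, k ∈ {1,2,3}] and let G = SL_2(ℂ) × SL_3(ℂ) × SL_3(ℂ) act on R by ℂ-algebra automorphisms determined by the linear substitution (g_1,g_2,g_3)·x_{ijk} = Σ_{i',j',k'} (g_1)_{i'i}(g_2)_{j'j}(g_3)_{k'k} x_{i'j'k'}. For every natural number d, the ℂ-vector space of polynomials in R that are homogeneous of degree d and fixed by every element of G has dimension 1 if 12 divides d, and dimension 0 otherwise. (This corresponds to the Dynkin diagram E_6, whose fundamental invariant has degree 12, and shows that (6^2, 4^3, 4^3) is a weakly stable triple.) -/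

import Mathlib

noncomputable section

/-- The action of `(g₁, g₂, g₃) ∈ SL_{n₁}(ℂ) × SL_{n₂}(ℂ) × SL_{n₃}(ℂ)` on the
polynomial ring `ℂ[x_v : v ∈ Fin n₁ × Fin n₂ × Fin n₃]` by the linear substitution
`x_{ijk} ↦ ∑_{i',j',k'} (g₁)_{i'i} (g₂)_{j'j} (g₃)_{k'k} x_{i'j'k'}`. -/
def act (n₁ n₂ n₃ : ℕ)
    (g : Matrix.SpecialLinearGroup (Fin n₁) ℂ × Matrix.SpecialLinearGroup (Fin n₂) ℂ ×
      Matrix.SpecialLinearGroup (Fin n₃) ℂ) :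
    MvPolynomial (Fin n₁ × Fin n₂ × Fin n₃) ℂ →ₐ[ℂ] MvPolynomial (Fin n₁ × Fin n₂ × Fin n₃) ℂ :=
  MvPolynomial.aeval fun v : Fin n₁ × Fin n₂ × Fin n₃ =>
    ∑ w : Fin n₁ × Fin n₂ × Fin n₃,
      (g.1.val w.1 v.1 * g.2.1.val w.2.1 v.2.1 * g.2.2.val w.2.2 v.2.2) •
        (MvPolynomial.X w : MvPolynomial (Fin n₁ × Fin n₂ × Fin n₃) ℂ)

/-- The space of polynomials homogeneous of degree `d` fixed by every element of
`SL_{n₁}(ℂ) × SL_{n₂}(ℂ) × SL_{n₃}(ℂ)`. -/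
def invSpace (n₁ n₂ n₃ d : ℕ) :
    Submodule ℂ (MvPolynomial (Fin n₁ × Fin n₂ × Fin n₃) ℂ) :=
  MvPolynomial.homogeneousSubmodule (Fin n₁ × Fin n₂ × Fin n₃) ℂ d ⊓
    ⨅ g : Matrix.SpecialLinearGroup (Fin n₁) ℂ × Matrix.SpecialLinearGroup (Fin n₂) ℂ ×
        Matrix.SpecialLinearGroup (Fin n₃) ℂ,
      LinearMap.eqLocus (act n₁ n₂ n₃ g).toLinearMap LinearMap.id

open Matrix MvPolynomial

/-- The tensor in `ℂ² ⊗ ℂ³ ⊗ ℂ³` whose two slices are the matrices `A` and `B`. -/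
def slices (A B : Matrix (Fin 3) (Fin 3) ℂ) : Fin 2 × Fin 3 × Fin 3 → ℂ :=
  fun v => (![A, B] : Fin 2 → Matrix (Fin 3) (Fin 3) ℂ) v.1 v.2.1 v.2.2

theorem exists_eq_slices (p : Fin 2 × Fin 3 × Fin 3 → ℂ) : ∃ A B, p = slices A B := by
  refine ⟨of fun j k => p (0, j, k), of fun j k => p (1, j, k), ?_⟩
  ext ⟨i, j, k⟩
  fin_cases i <;> simp [slices]

theorem smul_slices (c : ℂ) (A B : Matrix (Fin 3) (Fin 3) ℂ) :
    c • slices A B = slices (c • A) (c • B) := by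
  ext ⟨i, j, k⟩
  fin_cases i <;> simp [slices]

theorem eval_act (g₁ : SpecialLinearGroup (Fin 2) ℂ) (g₂ g₃ : SpecialLinearGroup (Fin 3) ℂ)
    (f : MvPolynomial (Fin 2 × Fin 3 × Fin 3) ℂ) (A B : Matrix (Fin 3) (Fin 3) ℂ) :
    eval (slices A B) (act 2 3 3 (g₁, g₂, g₃) f) =
      eval (slices (g₂.valᵀ * (g₁.val 0 0 • A + g₁.val 1 0 • B) * g₃.val)
        (g₂.valᵀ * (g₁.val 0 1 • A + g₁.val 1 1 • B) * g₃.val)) f := by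
  have h : (eval (slices A B)).comp (act 2 3 3 (g₁, g₂, g₃)).toRingHom =
      eval (slices (g₂.valᵀ * (g₁.val 0 0 • A + g₁.val 1 0 • B) * g₃.val)
        (g₂.valᵀ * (g₁.val 0 1 • A + g₁.val 1 1 • B) * g₃.val)) := by
    apply MvPolynomial.ringHom_ext
    · intro r
      simp [act]
    · rintro ⟨i, j, k⟩
      fin_cases i <;>
      · simp [act, slices, Fintype.sum_prod_type, Fin.sum_univ_two, Fin.sum_univ_three,
          Matrix.mul_apply, smul_eval]
        ring
  exact congrArg (fun φ : MvPolynomial (Fin 2 × Fin 3 × Fin 3) ℂ →+* ℂ => φ f) h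

theorem eval_smul_of_isHomogeneous {σ R : Type*} [CommSemiring R] {f : MvPolynomial σ R} {d : ℕ}
    (hf : f.IsHomogeneous d) (c : R) (p : σ → R) : eval (c • p) f = c ^ d * eval p f := by
  rw [eval_eq, eval_eq, Finset.mul_sum]
  refine Finset.sum_congr rfl fun m hm => ?_
  have hd : ∑ i ∈ m.support, m i = d := by
    simpa [Finsupp.weight_apply, Finsupp.sum] using hf (mem_support_iff.1 hm)
  simp only [Pi.smul_apply, smul_eq_mul, mul_pow, Finset.prod_mul_distrib, Finset.prod_pow_eq_pow_sum,
    hd]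
  ring

section Invariants

variable {d : ℕ} {f : MvPolynomial (Fin 2 × Fin 3 × Fin 3) ℂ}

theorem mem_invSpace_iff {n₁ n₂ n₃ d : ℕ} {f : MvPolynomial (Fin n₁ × Fin n₂ × Fin n₃) ℂ} :
    f ∈ invSpace n₁ n₂ n₃ d ↔ f.IsHomogeneous d ∧ ∀ g, act n₁ n₂ n₃ g f = f := by
  simp [invSpace, Submodule.mem_iInf, LinearMap.mem_eqLocus]

theorem eval_smul_slices (hf : f ∈ invSpace 2 3 3 d) (c : ℂ) (A B : Matrix (Fin 3) (Fin 3) ℂ) :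
    eval (slices (c • A) (c • B)) f = c ^ d * eval (slices A B) f := by
  rw [← smul_slices, eval_smul_of_isHomogeneous (mem_invSpace_iff.1 hf).1]

theorem eval_slices_mul_mul (hf : f ∈ invSpace 2 3 3 d) {g h : Matrix (Fin 3) (Fin 3) ℂ}
    (hg : g.det = 1) (hh : h.det = 1) (A B : Matrix (Fin 3) (Fin 3) ℂ) :
    eval (slices (g * A * h) (g * B * h)) f = eval (slices A B) f := by
  have := eval_act 1 ⟨gᵀ, by rwa [det_transpose]⟩ ⟨h, hh⟩ f A B
  rw [(mem_invSpace_iff.1 hf).2] at this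
  simpa using this.symm

theorem eval_slices_comb (hf : f ∈ invSpace 2 3 3 d) {a b c e : ℂ} (h : a * e - b * c = 1)
    (A B : Matrix (Fin 3) (Fin 3) ℂ) :
    eval (slices (a • A + b • B) (c • A + e • B)) f = eval (slices A B) f := by
  have := eval_act ⟨!![a, c; b, e], by rw [det_fin_two_of]; linear_combination h⟩ 1 1 f A B
  rw [(mem_invSpace_iff.1 hf).2] at this
  simpa using this.symm

theorem exists_smul_det_eq_one {n : ℕ} (hn : n ≠ 0) {g : Matrix (Fin n) (Fin n) ℂ}
    (hg : g.det ≠ 0) : ∃ c : ℂ, ∃ g' : Matrix (Fin n) (Fin n) ℂ, g'.det = 1 ∧ g = c • g' := by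
  obtain ⟨c, hc⟩ := IsAlgClosed.exists_pow_nat_eq g.det (Nat.pos_of_ne_zero hn)
  have hc0 : c ≠ 0 := by
    rintro rfl
    exact hg (by rw [← hc, zero_pow hn])
  refine ⟨c, c⁻¹ • g, ?_, (smul_inv_smul₀ hc0 g).symm⟩
  rw [det_smul, Fintype.card_fin, ← hc, inv_pow, inv_mul_cancel₀ (pow_ne_zero _ hc0)]

theorem eval_slices_mul_mul_eq_zero (hf : f ∈ invSpace 2 3 3 d) {g h : Matrix (Fin 3) (Fin 3) ℂ}
    (hg : g.det ≠ 0) (hh : h.det ≠ 0) {A B : Matrix (Fin 3) (Fin 3) ℂ}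
    (h0 : eval (slices A B) f = 0) : eval (slices (g * A * h) (g * B * h)) f = 0 := by
  obtain ⟨c, g', hg', rfl⟩ := exists_smul_det_eq_one three_ne_zero hg
  obtain ⟨e, h', hh', rfl⟩ := exists_smul_det_eq_one three_ne_zero hh
  simp only [Matrix.smul_mul, Matrix.mul_smul]
  rw [eval_smul_slices hf, eval_smul_slices hf, eval_slices_mul_mul hf hg' hh', h0, mul_zero,
    mul_zero]

theorem eval_slices_comb_eq_zero (hf : f ∈ invSpace 2 3 3 d) {a b c e : ℂ}
    (h : a * e - b * c ≠ 0) {A B : Matrix (Fin 3) (Fin 3) ℂ} (h0 : eval (slices A B) f = 0) :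
    eval (slices (a • A + b • B) (c • A + e • B)) f = 0 := by
  obtain ⟨r, g, hg, hr⟩ := exists_smul_det_eq_one (g := !![a, b; c, e]) two_ne_zero
    (by rwa [det_fin_two_of])
  have h00 : a = r * g 0 0 := by simpa using congrFun₂ hr 0 0
  have h01 : b = r * g 0 1 := by simpa using congrFun₂ hr 0 1
  have h10 : c = r * g 1 0 := by simpa using congrFun₂ hr 1 0
  have h11 : e = r * g 1 1 := by simpa using congrFun₂ hr 1 1
  rw [det_fin_two] at hg
  rw [h00, h01, h10, h11]
  simp only [mul_smul, ← smul_add]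
  rw [eval_smul_slices hf, eval_slices_comb hf hg, h0, mul_zero]

end Invariants

section Discriminant

/-- The binary cubic `2 * det (s • A + t • B)`, written as a cubic polynomial in `s`. -/
def pencilCubic {R : Type*} [CommRing R] (A B : Matrix (Fin 3) (Fin 3) R) : Cubic R :=
  ⟨2 * A.det, (A + B).det - (A - B).det - 2 * B.det, (A + B).det + (A - B).det - 2 * A.det,
    2 * B.det⟩

variable {R : Type*} [CommRing R] (A B : Matrix (Fin 3) (Fin 3) R)

theorem two_mul_det_smul_add_smul (s t : R) :
    2 * (s • A + t • B).det = (pencilCubic A B).a * s ^ 3 + (pencilCubic A B).b * s ^ 2 * t +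
      (pencilCubic A B).c * s * t ^ 2 + (pencilCubic A B).d * t ^ 3 := by
  simp only [pencilCubic, det_fin_three, Matrix.add_apply, Matrix.sub_apply,
    Matrix.smul_apply, smul_eq_mul]
  ring

theorem discr_pencilCubic_mul_mul {g h : Matrix (Fin 3) (Fin 3) R} (hg : g.det = 1)
    (hh : h.det = 1) :
    (pencilCubic (g * A * h) (g * B * h)).discr = (pencilCubic A B).discr := by
  simp only [pencilCubic, ← Matrix.add_mul, ← Matrix.sub_mul, ← Matrix.mul_add, ← Matrix.mul_sub,
    det_mul, hg, hh, one_mul, mul_one]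

theorem discr_pencilCubic_comb [NoZeroDivisors R] [CharZero R] (a b c e : R) :
    (pencilCubic (a • A + b • B) (c • A + e • B)).discr =
      (a * e - b * c) ^ 6 * (pencilCubic A B).discr := by
  have h₁ := two_mul_det_smul_add_smul A B a b
  have h₂ := two_mul_det_smul_add_smul A B c e
  have h₃ := two_mul_det_smul_add_smul A B (a + c) (b + e)
  have h₄ := two_mul_det_smul_add_smul A B (a - c) (b - e)
  have e₃ : a • A + b • B + (c • A + e • B) = (a + c) • A + (b + e) • B := by module
  have e₄ : a • A + b • B - (c • A + e • B) = (a - c) • A + (b - e) • B := by module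
  generalize pencilCubic A B = P at *
  have hb : 2 * (((a + c) • A + (b + e) • B).det - ((a - c) • A + (b - e) • B).det -
      2 * (c • A + e • B).det) = 2 * (3 * P.a * a ^ 2 * c + P.b * (a ^ 2 * e + 2 * a * b * c) +
      P.c * (b ^ 2 * c + 2 * a * b * e) + 3 * P.d * b ^ 2 * e) := by
    linear_combination h₃ - h₄ - 2 * h₂
  have hc : 2 * (((a + c) • A + (b + e) • B).det + ((a - c) • A + (b - e) • B).det -
      2 * (a • A + b • B).det) = 2 * (3 * P.a * a * c ^ 2 + P.b * (b * c ^ 2 + 2 * a * c * e) +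
      P.c * (a * e ^ 2 + 2 * b * c * e) + 3 * P.d * b * e ^ 2) := by
    linear_combination h₃ + h₄ - 2 * h₁
  have hb' := mul_left_cancel₀ two_ne_zero hb
  have hc' := mul_left_cancel₀ two_ne_zero hc
  rw [pencilCubic, e₃, e₄, hb', hc', h₁, h₂]
  simp only [Cubic.discr]
  ring

theorem map_discr_pencilCubic {S : Type*} [CommRing S] (φ : R →+* S) :
    φ (pencilCubic A B).discr = (pencilCubic (A.map φ) (B.map φ)).discr := by
  have hd (M : Matrix (Fin 3) (Fin 3) R) : φ M.det = (M.map φ).det := φ.map_det M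
  have ha : (A + B).map φ = A.map φ + B.map φ := Matrix.map_add φ (map_add φ) A B
  have hs : (A - B).map φ = A.map φ - B.map φ := Matrix.map_sub φ (map_sub φ) A B
  simp only [pencilCubic, Cubic.discr, map_add, map_sub, map_mul, map_pow, map_ofNat, hd, ha, hs]

end Discriminant

/-- The slice of the generic tensor with first index `i`. -/
def genericSlice (i : Fin 2) : Matrix (Fin 3) (Fin 3) (MvPolynomial (Fin 2 × Fin 3 × Fin 3) ℂ) :=
  of fun j k => X (i, j, k)

/-- The discriminant of the binary cubic attached to the generic pencil of `3 × 3` matrices. -/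
def tensorDiscr : MvPolynomial (Fin 2 × Fin 3 × Fin 3) ℂ :=
  (pencilCubic (genericSlice 0) (genericSlice 1)).discr

theorem genericSlice_zero_map (A B : Matrix (Fin 3) (Fin 3) ℂ) :
    (genericSlice 0).map (eval (slices A B)) = A := by
  ext j k
  simp [genericSlice, slices]

theorem genericSlice_one_map (A B : Matrix (Fin 3) (Fin 3) ℂ) :
    (genericSlice 1).map (eval (slices A B)) = B := by
  ext j k
  simp [genericSlice, slices]

theorem eval_tensorDiscr (A B : Matrix (Fin 3) (Fin 3) ℂ) :
    eval (slices A B) tensorDiscr = (pencilCubic A B).discr := by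
  rw [tensorDiscr, map_discr_pencilCubic, genericSlice_zero_map, genericSlice_one_map]

theorem isHomogeneous_det_of_isHomogeneous_one {σ R : Type*} [CommRing R] {n : ℕ}
    {M : Matrix (Fin n) (Fin n) (MvPolynomial σ R)} (hM : ∀ i j, (M i j).IsHomogeneous 1) :
    M.det.IsHomogeneous n := by
  rw [det_apply']
  refine IsHomogeneous.sum _ _ _ fun τ _ => ?_
  have h := isHomogeneous_C σ (((τ.sign : ℤˣ) : ℤ) : R)
  rw [map_intCast] at h
  simpa using h.mul (IsHomogeneous.prod Finset.univ (fun i => M (τ i) i) (fun _ => 1)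
    fun i _ => hM _ _)

theorem isHomogeneous_natCast_mul {σ R : Type*} [CommRing R] {p : MvPolynomial σ R} {n : ℕ}
    (k : ℕ) [k.AtLeastTwo] (hp : p.IsHomogeneous n) : (ofNat(k) * p).IsHomogeneous n := by
  rw [← map_ofNat (C : R →+* MvPolynomial σ R)]
  simpa using (isHomogeneous_C σ (OfNat.ofNat k : R)).mul hp

theorem isHomogeneous_discr {σ R : Type*} [CommRing R] {P : Cubic (MvPolynomial σ R)} {n : ℕ}
    (ha : P.a.IsHomogeneous n) (hb : P.b.IsHomogeneous n) (hc : P.c.IsHomogeneous n)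
    (hd : P.d.IsHomogeneous n) : P.discr.IsHomogeneous (4 * n) := by
  have h₁ := (hb.pow 2).mul (hc.pow 2)
  have h₂ := isHomogeneous_natCast_mul 4 (ha.mul (hc.pow 3))
  have h₃ := isHomogeneous_natCast_mul 4 ((hb.pow 3).mul hd)
  have h₄ := isHomogeneous_natCast_mul 27 ((ha.pow 2).mul (hd.pow 2))
  have h₅ := isHomogeneous_natCast_mul 18 (((ha.mul hb).mul hc).mul hd)
  ring_nf at h₁ h₂ h₃ h₄ h₅
  have := (((h₁.sub h₂).sub h₃).sub h₄).add h₅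
  rw [Cubic.discr]
  ring_nf at this ⊢
  exact this

theorem isHomogeneous_tensorDiscr : tensorDiscr.IsHomogeneous 12 := by
  have h₀ (i j k) : (genericSlice i j k).IsHomogeneous 1 := isHomogeneous_X _ _
  have hA := isHomogeneous_det_of_isHomogeneous_one (h₀ 0)
  have hB := isHomogeneous_det_of_isHomogeneous_one (h₀ 1)
  have hs := isHomogeneous_det_of_isHomogeneous_one (M := genericSlice 0 + genericSlice 1)
    fun i j => (h₀ 0 i j).add (h₀ 1 i j)
  have hd := isHomogeneous_det_of_isHomogeneous_one (M := genericSlice 0 - genericSlice 1)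
    fun i j => (h₀ 0 i j).sub (h₀ 1 i j)
  exact isHomogeneous_discr (n := 3) (isHomogeneous_natCast_mul 2 hA)
    ((hs.sub hd).sub (isHomogeneous_natCast_mul 2 hB))
    ((hs.add hd).sub (isHomogeneous_natCast_mul 2 hA)) (isHomogeneous_natCast_mul 2 hB)

theorem tensorDiscr_mem_invSpace : tensorDiscr ∈ invSpace 2 3 3 12 := by
  refine mem_invSpace_iff.2 ⟨isHomogeneous_tensorDiscr, fun ⟨g₁, g₂, g₃⟩ => ?_⟩
  refine MvPolynomial.funext fun p => ?_
  obtain ⟨A, B, rfl⟩ := exists_eq_slices p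
  have h := g₁.2
  rw [det_fin_two] at h
  rw [eval_act, eval_tensorDiscr, eval_tensorDiscr,
    discr_pencilCubic_mul_mul _ _ (by rw [det_transpose]; exact g₂.2) g₃.2, discr_pencilCubic_comb,
    mul_comm (g₁.val 1 0), h, one_pow, one_mul]

theorem pow_tensorDiscr_mem_invSpace (m : ℕ) : tensorDiscr ^ m ∈ invSpace 2 3 3 (12 * m) := by
  obtain ⟨h₁, h₂⟩ := mem_invSpace_iff.1 tensorDiscr_mem_invSpace
  exact mem_invSpace_iff.2 ⟨h₁.pow m, fun g => by rw [map_pow, h₂]⟩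

/-- A diagonal pencil whose binary cubic has three distinct roots. -/
def baseTensor : Fin 2 × Fin 3 × Fin 3 → ℂ :=
  slices (diagonal ![1, 0, 1]) (diagonal ![0, 1, 1])

theorem eval_baseTensor_tensorDiscr : eval baseTensor tensorDiscr = 16 := by
  rw [baseTensor, eval_tensorDiscr]
  simp [pencilCubic, Cubic.discr, Fin.prod_univ_three]
  norm_num

/-- A regular pencil with nonzero discriminant can be diagonalized by left and right
multiplication. -/
theorem exists_eq_mul_diagonal_mul {A B : Matrix (Fin 3) (Fin 3) ℂ} (hA : A.det ≠ 0)
    (h : (pencilCubic A B).discr ≠ 0) :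
    ∃ g k : Matrix (Fin 3) (Fin 3) ℂ, ∃ x y z : ℂ, g.det ≠ 0 ∧ k.det ≠ 0 ∧
      x ≠ y ∧ x ≠ z ∧ y ≠ z ∧ A = g * k ∧ B = g * diagonal ![x, y, z] * k := by
  let P : Cubic ℂ := ⟨(pencilCubic A B).a, -(pencilCubic A B).b, (pencilCubic A B).c,
    -(pencilCubic A B).d⟩
  have hP : P.discr ≠ 0 := by
    convert h using 1
    simp only [Cubic.discr, P]
    ring
  have ha : P.a ≠ 0 := mul_ne_zero two_ne_zero hA
  obtain ⟨x, y, z, hr⟩ := (Cubic.splits_iff_roots_eq_three (φ := RingHom.id ℂ) ha).1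
    (IsAlgClosed.splits _)
  obtain ⟨hxy, hxz, hyz⟩ := (Cubic.discr_ne_zero_iff_roots_ne ha hr).1 hP
  have hroot (t : ℂ) (ht : t ∈ ({x, y, z} : Multiset ℂ)) : (t • A - B).det = 0 := by
    rw [← hr, Cubic.mem_roots_iff (Cubic.ne_zero_of_a_ne_zero (by simpa [Cubic.map] using ha))] at ht
    have h2 := two_mul_det_smul_add_smul A B t (-1)
    rw [neg_one_smul, ← sub_eq_add_neg] at h2
    refine (mul_eq_zero.1 (h2.trans ?_)).resolve_left two_ne_zero
    simp only [Cubic.map, RingHom.id_apply, P] at ht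
    linear_combination ht
  have hdet (i : Fin 3) : ((![x, y, z] i) • A - B).det = 0 := by
    apply hroot
    fin_cases i <;> simp
  choose v hv0 hv using fun i => exists_mulVec_eq_zero_iff.2 (hdet i)
  have hB (i : Fin 3) : B *ᵥ v i = (![x, y, z] i) • A *ᵥ v i := by
    have := hv i
    rw [sub_mulVec, smul_mulVec, sub_eq_zero] at this
    exact this.symm
  have hAu : IsUnit A.det := isUnit_iff_ne_zero.2 hA
  have hinj : Function.Injective ![x, y, z] := by
    intro i j hij
    fin_cases i <;> fin_cases j <;> simp_all
  have hli : LinearIndependent ℂ v := by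
    refine Module.End.eigenvectors_linearIndependent' (Matrix.toLin' (A⁻¹ * B)) ![x, y, z] hinj v
      fun i => ⟨Module.End.mem_eigenspace_iff.2 ?_, hv0 i⟩
    rw [toLin'_apply, ← mulVec_mulVec, hB, mulVec_smul, mulVec_mulVec, nonsing_inv_mul _ hAu,
      one_mulVec]
  let S : Matrix (Fin 3) (Fin 3) ℂ := (of v)ᵀ
  have hS : IsUnit S.det := by
    rw [← isUnit_iff_isUnit_det, ← linearIndependent_cols_iff_isUnit]
    exact hli
  have hBS : B * S = A * S * diagonal ![x, y, z] := by
    ext i j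
    rw [mul_diagonal, mul_comm]
    exact congrFun (hB j) i
  refine ⟨A * S, S⁻¹, x, y, z, ?_, ?_, hxy, hxz, hyz, ?_, ?_⟩
  · rw [det_mul]
    exact mul_ne_zero hA hS.ne_zero
  · exact ((isUnit_nonsing_inv_det_iff).2 hS).ne_zero
  · rw [mul_nonsing_inv_cancel_right _ _ hS]
  · rw [← hBS, mul_nonsing_inv_cancel_right _ _ hS]

section Uniqueness

variable {d : ℕ} {f : MvPolynomial (Fin 2 × Fin 3 × Fin 3) ℂ}

theorem eval_slices_one_diagonal_eq_zero (hf : f ∈ invSpace 2 3 3 d) (h0 : eval baseTensor f = 0)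
    {x y z : ℂ} (hxy : x ≠ y) (hxz : x ≠ z) (hyz : y ≠ z) :
    eval (slices 1 (diagonal ![x, y, z])) f = 0 := by
  have hu : z - y ≠ 0 := sub_ne_zero.2 hyz.symm
  have hv : x - z ≠ 0 := sub_ne_zero.2 hxz
  have hw : x - y ≠ 0 := sub_ne_zero.2 hxy
  have h₁ := eval_slices_comb_eq_zero hf (a := z - y) (b := x - z) (c := (z - y) * x)
    (e := (x - z) * y)
    (by
      have := mul_ne_zero (mul_ne_zero hu hv) (sub_ne_zero.2 hxy.symm)
      convert this using 1
      ring) h0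
  have h₂ := eval_slices_mul_mul_eq_zero hf (g := 1)
    (h := diagonal ![(z - y)⁻¹, (x - z)⁻¹, (x - y)⁻¹]) (by simp)
    (by simp [det_diagonal, Fin.prod_univ_three, hu, hv, hw]) h₁
  convert h₂ using 4
  · ext i j
    fin_cases i <;> fin_cases j <;> simp [hu, hv]
    field_simp
  · ext i j
    fin_cases i <;> fin_cases j <;> simp <;> field_simp
    ring

theorem eq_zero_of_eval_baseTensor_eq_zero (hf : f ∈ invSpace 2 3 3 d)
    (h0 : eval baseTensor f = 0) : f = 0 := by
  have hdet : (genericSlice 0).det ≠ 0 := by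
    intro h
    have := congrArg (eval (slices 1 0)) h
    rw [RingHom.map_det, RingHom.mapMatrix_apply, genericSlice_zero_map] at this
    simp at this
  have hdisc : tensorDiscr ≠ 0 := by
    intro h
    have := eval_baseTensor_tensorDiscr
    rw [h] at this
    norm_num at this
  have hzero : f * ((genericSlice 0).det * tensorDiscr) = 0 := by
    refine MvPolynomial.funext fun p => ?_
    obtain ⟨A, B, rfl⟩ := exists_eq_slices p
    rw [map_mul, map_mul, map_zero, eval_tensorDiscr, RingHom.map_det, RingHom.mapMatrix_apply,
      genericSlice_zero_map]
    by_contra hne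
    obtain ⟨hne, hA, hD⟩ := by simpa only [mul_ne_zero_iff] using hne
    obtain ⟨g, k, x, y, z, hg, hk, hxy, hxz, hyz, rfl, rfl⟩ := exists_eq_mul_diagonal_mul hA hD
    refine hne ?_
    simpa using eval_slices_mul_mul_eq_zero hf hg hk
      (eval_slices_one_diagonal_eq_zero hf h0 hxy hxz hyz)
  exact (mul_eq_zero.1 hzero).resolve_right (mul_ne_zero hdet hdisc)

theorem twelve_dvd_of_eval_baseTensor_ne_zero (hf : f ∈ invSpace 2 3 3 d)
    (h0 : eval baseTensor f ≠ 0) : 12 ∣ d := by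
  have h3 : 3 ∣ d := by
    have hω := Complex.isPrimitiveRoot_exp 3 three_ne_zero
    set ω := Complex.exp (2 * Real.pi * Complex.I / (3 : ℕ))
    have h := eval_slices_mul_mul hf (g := ω • 1) (h := 1) (by simp [hω.pow_eq_one])
      det_one (diagonal ![1, 0, 1]) (diagonal ![0, 1, 1])
    simp only [Matrix.smul_mul, Matrix.one_mul, Matrix.mul_one] at h
    rw [eval_smul_slices hf] at h
    exact hω.dvd_of_pow_eq_one d ((mul_eq_right₀ h0).1 h)
  have h4 : 4 ∣ d := by
    let T : Matrix (Fin 3) (Fin 3) ℂ := !![0, -1, 0; -1, 0, 0; 0, 0, -1]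
    have hT : T.det = 1 := by simp [T, det_fin_three]
    have hI := eval_slices_comb hf (a := 0) (b := Complex.I) (c := Complex.I) (e := 0) (by simp)
      (T * diagonal ![1, 0, 1] * T) (T * diagonal ![0, 1, 1] * T)
    rw [eval_slices_mul_mul hf hT hT] at hI
    have hA : T * diagonal ![1, 0, 1] * T = diagonal ![0, 1, 1] := by
      ext i j
      fin_cases i <;> fin_cases j <;> simp [T, Matrix.mul_apply, Fin.sum_univ_three, vecMul_diagonal]
    have hB : T * diagonal ![0, 1, 1] * T = diagonal ![1, 0, 1] := by
      ext i j
      fin_cases i <;> fin_cases j <;> simp [T, Matrix.mul_apply, Fin.sum_univ_three, vecMul_diagonal]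
    rw [hA, hB, zero_smul, zero_smul, zero_add, add_zero, eval_smul_slices hf] at hI
    exact Complex.isPrimitiveRoot_I.dvd_of_pow_eq_one d ((mul_eq_right₀ h0).1 hI)
  omega

end Uniqueness

/-- for the action of `SL₂(ℂ) × SL₃(ℂ) × SL₃(ℂ)` on `ℂ[x_{ijk}]`, the space of invariant polynomials homogeneous of degree `d` has dimension `1` if `12 ∣ d` and `0` otherwise (Dynkin diagram `E₆`; `(6², 4³, 4³)` is weakly stable). -/
theorem stmt13 (d : ℕ) :
    Module.rank ℂ ↥(invSpace 2 3 3 d) = if 12 ∣ d then 1 else 0 := by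
  let φ : invSpace 2 3 3 d →ₗ[ℂ] ℂ :=
    (aeval baseTensor : MvPolynomial (Fin 2 × Fin 3 × Fin 3) ℂ →ₐ[ℂ] ℂ).toLinearMap ∘ₗ
      (invSpace 2 3 3 d).subtype
  have hφ (f : invSpace 2 3 3 d) : φ f = eval baseTensor f.1 := by
    simp [φ, aeval_eq_eval]
  have hinj : Function.Injective φ := by
    refine (injective_iff_map_eq_zero φ).2 fun f hf => Subtype.ext ?_
    exact eq_zero_of_eval_baseTensor_eq_zero f.2 (by rwa [← hφ])
  split_ifs with hd
  · obtain ⟨m, rfl⟩ := hd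
    have hne : φ ⟨_, pow_tensorDiscr_mem_invSpace m⟩ ≠ 0 := by
      rw [hφ, map_pow, eval_baseTensor_tensorDiscr]
      exact pow_ne_zero _ (by norm_num)
    have hsurj : Function.Surjective φ := LinearMap.surjective fun h => hne (by rw [h]; rfl)
    rw [(LinearEquiv.ofBijective φ ⟨hinj, hsurj⟩).rank_eq, Module.rank_self]
  · refine rank_eq_zero_iff.2 fun f => ⟨1, one_ne_zero, ?_⟩
    have hf : φ f = 0 := by
      by_contra h
      exact hd (twelve_dvd_of_eval_baseTensor_ne_zero f.2 (by rwa [← hφ]))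
    rw [one_smul]
    exact hinj (by rw [hf, map_zero])
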